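/- Monotonicity of the polarized σₖ: if A, B, A₂, ..., A_k are symmetric n×n matrices with A − B having eigenvalues in Γₖ⁺ and each Aⱼ (j = 2,...,k) having eigenvalues in Γₖ⁺, then Σ_k(B, A₂, ..., A_k) < Σ_k(A, A₂, ..., A_k). -/

import Mathlib

/-- The `k`-th elementary symmetric polynomial of `lam : Fin n → ℝ`. -/
noncomputable def esymm (n k : ℕ) (lam : Fin n → ℝ) : ℝ :=
  ∑ s ∈ Finset.powersetCard k (Finset.univ : Finset (Fin n)), ∏ i ∈ s, lam i

/-- Membership in the Garding cone `Γₖ⁺`: all `σⱼ > 0` for `1 ≤ j ≤ k`. -/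
def inGamma (n k : ℕ) (lam : Fin n → ℝ) : Prop :=
  ∀ j : ℕ, 1 ≤ j → j ≤ k → 0 < esymm n j lam

/-- The generalized Kronecker delta `δ^{i₁...iₖ}_{j₁...jₖ}`:
the determinant of the matrix of ordinary Kronecker deltas. -/
noncomputable def gkdelta {k n : ℕ} (i j : Fin k → Fin n) : ℝ :=
  Matrix.det (Matrix.of fun a b : Fin k => if i a = j b then (1 : ℝ) else 0)

/-- The polarization `Σ_k(A₁,...,A_k) = (1/(k-1)!) δ^{i₁...iₖ}_{j₁...jₖ}
(A₁)_{i₁j₁}⋯(A_k)_{iₖjₖ}` of the `k`-th elementary symmetric function. -/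
noncomputable def polSigma (n k : ℕ) (A : Fin k → Matrix (Fin n) (Fin n) ℝ) : ℝ :=
  (1 / (Nat.factorial (k - 1) : ℝ)) *
    ∑ i : Fin k → Fin n, ∑ j : Fin k → Fin n,
      gkdelta i j * ∏ a : Fin k, A a (i a) (j a)

/-- The polarized Newton transformation tensor
`[Tₖ]_{pq}(A₁,...,Aₖ) = (1/k!) δ^{p,i₁,...,iₖ}_{q,j₁,...,jₖ} (A₁)_{i₁j₁}⋯(Aₖ)_{iₖjₖ}`. -/
noncomputable def polNewton (n k : ℕ) (A : Fin k → Matrix (Fin n) (Fin n) ℝ) :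
    Matrix (Fin n) (Fin n) ℝ :=
  Matrix.of fun p q : Fin n =>
    (1 / (Nat.factorial k : ℝ)) *
      ∑ i : Fin k → Fin n, ∑ j : Fin k → Fin n,
        gkdelta (Fin.cons p i) (Fin.cons q j) * ∏ a : Fin k, A a (i a) (j a)

section Garding

set_option linter.unusedSectionVars false

variable {W : Type*} [AddCommGroup W] [Module ℂ W]

/-- The polynomial `t ↦ M(x+ta,…,x+ta)`. -/
lemma exists_line_poly : ∀ (k : ℕ) (M : MultilinearMap ℂ (fun _ : Fin k => W) ℂ) (x a : W),
    ∃ p : Polynomial ℂ, (∀ t, p.eval t = M (fun _ => x + t • a)) ∧ p.natDegree ≤ k ∧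
      p.coeff k = M (fun _ => a) ∧
      ∀ t, p.derivative.eval t = ∑ i, M (Function.update (fun _ => x + t • a) i a) := by
  intro k
  induction k with
  | zero =>
    intro M x a
    refine ⟨Polynomial.C (M (fun _ => a)), fun t => ?_, by simp, by simp, by simp⟩
    rw [Polynomial.eval_C]
    congr 1
    exact Subsingleton.elim _ _
  | succ k ih =>
    intro M x a
    obtain ⟨p, hp1, hp2, hp3, hp4⟩ := ih (M.curryLeft x) x a
    obtain ⟨q, hq1, hq2, hq3, hq4⟩ := ih (M.curryLeft a) x a
    have hc : ∀ (v : Fin k → W) (t : ℂ),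
        M (Fin.cons (x + t • a) v) = M.curryLeft x v + t * M.curryLeft a v := by
      intro v t
      have : M.curryLeft (x + t • a) v = M.curryLeft x v + t * M.curryLeft a v := by
        rw [map_add, map_smul]; simp
      rwa [MultilinearMap.curryLeft_apply] at this
    have hcons : ∀ y : W, (fun _ : Fin (k+1) => y) = Fin.cons y (fun _ : Fin k => y) := by
      intro y; funext i; refine Fin.cases ?_ (fun j => ?_) i <;> simp
    refine ⟨p + Polynomial.X * q, fun t => ?_, ?_, ?_, fun t => ?_⟩
    · rw [hcons, hc]
      simp [hp1, hq1]
    · refine (Polynomial.natDegree_add_le _ _).trans (max_le (by omega) ?_)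
      refine (Polynomial.natDegree_mul_le).trans ?_
      have := Polynomial.natDegree_X_le (R := ℂ)
      omega
    · rw [Polynomial.coeff_add, Polynomial.coeff_X_mul, hq3,
        Polynomial.coeff_eq_zero_of_natDegree_lt (by omega), hcons a]
      simp
    · rw [Fin.sum_univ_succ]
      have h0 : Function.update (fun _ : Fin (k+1) => x + t • a) 0 a
          = Fin.cons a (fun _ => x + t • a) := by
        rw [hcons, Fin.update_cons_zero]
      have h1 : ∀ i : Fin k, Function.update (fun _ : Fin (k+1) => x + t • a) i.succ a
          = Fin.cons (x + t • a) (Function.update (fun _ => x + t • a) i a) := by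
        intro i
        rw [hcons, ← Fin.cons_update]
      simp only [h0, h1, hc, Finset.sum_add_distrib, ← Finset.mul_sum, ← hp4, ← hq4]
      simp [hq1]
      ring

/-- symmetry of a multilinear form -/
def MSymm {k : ℕ} (M : MultilinearMap ℂ (fun _ : Fin k => W) ℂ) : Prop :=
  ∀ (σ : Equiv.Perm (Fin k)) (v : Fin k → W), M (v ∘ σ) = M v

lemma MSymm.curryLeft {k : ℕ} {M : MultilinearMap ℂ (fun _ : Fin (k+1) => W) ℂ} (h : MSymm M)
    (a : W) : MSymm (M.curryLeft a) := by
  intro σ v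
  have := h (Equiv.Perm.decomposeFin.symm (0, σ)) (Fin.cons a v)
  simp only [MultilinearMap.curryLeft_apply]
  rw [← this]
  congr 1
  funext i
  refine Fin.cases ?_ (fun j => ?_) i <;> simp

lemma MSymm.update {k : ℕ} {M : MultilinearMap ℂ (fun _ : Fin (k+1) => W) ℂ} (h : MSymm M)
    (a y : W) (i : Fin (k+1)) :
    M (Function.update (fun _ => y) i a) = M.curryLeft a (fun _ => y) := by
  rw [MultilinearMap.curryLeft_apply, ← h (Equiv.swap 0 i)]
  congr 1
  funext j
  simp only [Function.comp, Function.update_apply]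
  have : (Equiv.swap 0 i j = i) ↔ j = 0 := by
    rw [Equiv.swap_apply_eq_iff]; simp
  rw [if_congr this rfl rfl]
  refine Fin.cases ?_ (fun j => ?_) j <;> simp

lemma homog {k : ℕ} (M : MultilinearMap ℂ (fun _ : Fin k => W) ℂ) (c : ℂ) (x : W) :
    M (fun _ => c • x) = c ^ k * M (fun _ => x) := by
  have := M.map_smul_univ (fun _ => c) (fun _ => x)
  simpa using this

variable [TopologicalSpace W] [ContinuousAdd W] [ContinuousSMul ℂ W]

/-- persistence of roots -/
lemma root_persist {k : ℕ} (M : MultilinearMap ℂ (fun _ : Fin k => W) ℂ) (hM : Continuous M)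
    {a : W} (ha : M (fun _ => a) ≠ 0) {X : Type*} [TopologicalSpace X] (y : X → W)
    (hy : Continuous y) (ℓ : ℂ → ℝ) (hl : Continuous ℓ) (x₀ : X) (t₀ : ℂ) (ht : 0 < ℓ t₀)
    (h0 : M (fun _ => y x₀ + t₀ • a) = 0) :
    ∀ᶠ x in nhds x₀, ∃ t, 0 < ℓ t ∧ M (fun _ => y x + t • a) = 0 := by
  obtain ⟨ε, hε, hball⟩ := Metric.isOpen_iff.1 (isOpen_lt continuous_const hl) t₀ ht
  have hcont : Continuous fun x => ‖M (fun _ => y x + t₀ • a)‖ := by fun_prop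
  have hpos : 0 < ‖M (fun _ => a)‖ * ε ^ k := by positivity
  have hev : ∀ᶠ x in nhds x₀, ‖M (fun _ => y x + t₀ • a)‖ < ‖M (fun _ => a)‖ * ε ^ k := by
    refine hcont.continuousAt.eventually_lt continuousAt_const ?_
    simpa [h0] using hpos
  filter_upwards [hev] with x hx
  by_contra! hno
  obtain ⟨p, hp1, hp2, hp3, -⟩ := exists_line_poly k M (y x) a
  have hdeg : p.natDegree = k :=
    le_antisymm hp2 (Polynomial.le_natDegree_of_ne_zero (by rw [hp3]; exact ha))
  have hsp : p.Splits := IsAlgClosed.splits p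
  have hp0 : p ≠ 0 := by rintro rfl; apply ha; rw [← hp3]; simp
  have hev := hsp.eval_eq_prod_roots t₀
  have hcard : p.roots.card = k := by rw [← hdeg]; exact Polynomial.splits_iff_card_roots.1 hsp
  have hlc : p.leadingCoeff = M (fun _ => a) := by
    rw [Polynomial.leadingCoeff, hdeg, hp3]
  rw [hp1, hlc] at hev
  have hge : ∀ s : Multiset ℂ, (∀ r ∈ s, ε ≤ ‖t₀ - r‖) →
      ε ^ s.card ≤ ‖(s.map fun r => t₀ - r).prod‖ := by
    intro s
    induction s using Multiset.induction with
    | empty => simp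
    | cons r s ih =>
      intro h
      simp only [Multiset.card_cons, Multiset.map_cons, Multiset.prod_cons, norm_mul, pow_succ']
      exact mul_le_mul (h r (by simp)) (ih fun r hr => h r (by simp [hr])) (by positivity)
        (by positivity)
  have := hge p.roots (by
    intro r hr
    by_contra! hlt
    have hr' : r ∈ Metric.ball t₀ ε := by
      rw [Metric.mem_ball, dist_comm, dist_eq_norm]; exact hlt
    refine hno r (hball hr') ?_
    rw [← hp1]
    exact Polynomial.isRoot_of_mem_roots hr)
  rw [hcard] at this
  rw [hev, norm_mul] at hx
  have := mul_le_mul_of_nonneg_left this (norm_nonneg (M fun _ => a))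
  linarith

/-- Homotopy lemma: roots do not enter a half plane without crossing its boundary. -/
lemma homotopy_roots {k : ℕ} (M : MultilinearMap ℂ (fun _ : Fin k => W) ℂ) (hM : Continuous M)
    {a : W} (ha : M (fun _ => a) ≠ 0) (y : unitInterval → W)
    (hy : Continuous y) (ℓ : ℂ → ℝ) (hl : Continuous ℓ)
    (hbd : ∀ θ t, ℓ t = 0 → M (fun _ => y θ + t • a) ≠ 0)
    (h0 : ∀ t, 0 ≤ ℓ t → M (fun _ => y 0 + t • a) ≠ 0) :
    ∀ t, 0 ≤ ℓ t → M (fun _ => y 1 + t • a) ≠ 0 := by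
  set T : Set unitInterval := {θ | ∃ t, 0 ≤ ℓ t ∧ M (fun _ => y θ + t • a) = 0} with hT
  have hopen : IsOpen T := by
    rw [isOpen_iff_eventually]
    rintro θ ⟨t, ht, hroot⟩
    have ht' : 0 < ℓ t := lt_of_le_of_ne ht fun h => hbd θ t h.symm hroot
    filter_upwards [root_persist M hM ha y hy ℓ hl θ t ht' hroot] with x hx
    obtain ⟨t, h1, h2⟩ := hx
    exact ⟨t, h1.le, h2⟩
  have hbound : ∃ R : ℝ, ∀ (θ : unitInterval) (t : ℂ), M (fun _ => y θ + t • a) = 0 → ‖t‖ ≤ R := by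
    have hg : Continuous fun q : ℂ × unitInterval => M (fun _ => q.1 • y q.2 + a) := by
      fun_prop
    have := isCompact_univ.eventually_forall_of_forall_eventually (x₀ := (0:ℂ))
      (K := (Set.univ : Set unitInterval))
      (P := fun (u : ℂ) (θ : unitInterval) => M (fun _ => u • y θ + a) ≠ 0) (by
        intro θ _
        refine (hg.continuousAt).eventually_ne ?_
        simpa using ha)
    obtain ⟨ε, hε, hb⟩ := Metric.eventually_nhds_iff.1 this
    refine ⟨ε⁻¹, fun θ t hroot => ?_⟩
    by_contra! hlt
    have htpos : 0 < ‖t‖ := lt_trans (by positivity) hlt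
    have ht0 : t ≠ 0 := norm_pos_iff.1 htpos
    refine hb (y := t⁻¹) ?_ θ (Set.mem_univ _) ?_
    · rw [dist_zero_right, norm_inv]
      exact inv_lt_of_inv_lt₀ hε hlt
    · have h1 : t⁻¹ • y θ + a = t⁻¹ • (y θ + t • a) := by
        rw [smul_add, smul_smul, inv_mul_cancel₀ ht0, one_smul]
      rw [h1, homog, hroot, mul_zero]
  have hclosed : IsClosed T := by
    obtain ⟨R, hR⟩ := hbound
    have hK : IsCompact {q : unitInterval × ℂ | q.2 ∈ Metric.closedBall (0:ℂ) R ∧ 0 ≤ ℓ q.2 ∧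
        M (fun _ => y q.1 + q.2 • a) = 0} := by
      have hc1 : IsCompact ((Set.univ : Set unitInterval) ×ˢ Metric.closedBall (0:ℂ) R) :=
        isCompact_univ.prod (isCompact_closedBall _ _)
      refine hc1.of_isClosed_subset ?_ ?_
      · refine (Metric.isClosed_closedBall.preimage continuous_snd).inter (IsClosed.inter ?_ ?_)
        · exact isClosed_le continuous_const (hl.comp continuous_snd)
        · have hc2 : Continuous fun q : unitInterval × ℂ => M (fun _ => y q.1 + q.2 • a) := by
            fun_prop
          exact isClosed_eq hc2 continuous_const
      · rintro ⟨q1, q2⟩ ⟨h, -⟩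
        exact ⟨Set.mem_univ _, h⟩
    have himg := (hK.image continuous_fst).isClosed
    convert himg using 1
    ext θ
    constructor
    · rintro ⟨t, h1, h2⟩
      exact ⟨(θ, t), ⟨by simpa using hR θ t h2, h1, h2⟩, rfl⟩
    · rintro ⟨⟨θ', t⟩, ⟨-, h1, h2⟩, rfl⟩
      exact ⟨t, h1, h2⟩
  rcases isClopen_iff.1 ⟨hclosed, hopen⟩ with h | h
  · intro t ht hroot
    have : (1 : unitInterval) ∈ T := ⟨t, ht, hroot⟩
    rw [h] at this
    exact this
  · have : (0 : unitInterval) ∈ T := by rw [h]; trivial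
    obtain ⟨t, h1, h2⟩ := this
    exact absurd h2 (h0 t h1)

/-- Hyperbolicity of `M` in direction `e`, relative to a set `V` of real points. -/
def Hyp (V : Set W) {k : ℕ} (M : MultilinearMap ℂ (fun _ : Fin k => W) ℂ) (e : W) : Prop :=
  M (fun _ => e) ≠ 0 ∧ ∀ x ∈ V, ∀ t : ℂ, M (fun _ => x + t • e) = 0 → t.im = 0

/-- The hyperbolicity cone. -/
def InCone {k : ℕ} (M : MultilinearMap ℂ (fun _ : Fin k => W) ℂ) (e a : W) : Prop :=
  ∀ t : ℂ, M (fun _ => a + t • e) = 0 → t.re < 0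

lemma InCone.ne_zero {k : ℕ} {M : MultilinearMap ℂ (fun _ : Fin k => W) ℂ} {e a : W}
    (h : InCone M e a) : M (fun _ => a) ≠ 0 := by
  intro h0
  have := h 0 (by simpa using h0)
  simp at this


lemma Hyp.change {V : Set W} (hadd : ∀ x ∈ V, ∀ y ∈ V, x + y ∈ V)
    (hsmul : ∀ (r : ℝ), ∀ x ∈ V, (r : ℂ) • x ∈ V) {k : ℕ}
    {M : MultilinearMap ℂ (fun _ : Fin k => W) ℂ} (hM : Continuous M) {e a : W} (he : Hyp V M e) (haV : a ∈ V) (ha : InCone M e a) : Hyp V M a := by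
  have ha0 := ha.ne_zero
  -- no roots in the upper half plane after perturbation
  have key : ∀ x ∈ V, ∀ α : ℝ, 0 < α → ∀ s : ℂ, 0 ≤ s.im →
      M (fun _ => (x + ((α : ℂ) * Complex.I) • e) + s • a) ≠ 0 := by
    intro x hx α hα
    have := homotopy_roots M hM ha0
      (fun θ => (((θ : ℝ) : ℂ) • x + ((α : ℂ) * Complex.I) • e)) (by fun_prop) Complex.im
      Complex.continuous_im ?_ ?_
    · simpa using this
    · intro θ t ht hroot
      have hts : t = ((t.re : ℝ) : ℂ) := by
        apply Complex.ext <;> simp [ht]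
      have hV : ((θ : ℝ) : ℂ) • x + t • a ∈ V := by
        rw [hts]
        exact hadd _ (hsmul _ _ hx) _ (hsmul _ _ haV)
      have := he.2 _ hV ((α : ℂ) * Complex.I) (by rw [← hroot]; congr 1; funext _; abel)
      simp at this
      exact hα.ne' this
    · intro t ht hroot
      simp only [Set.Icc.coe_zero, Complex.ofReal_zero, zero_smul, zero_add] at hroot
      have hαI : ((α : ℂ) * Complex.I) ≠ 0 := by
        simp [hα.ne']
      by_cases ht0 : t = 0
      · subst ht0
        rw [zero_smul, add_zero, homog] at hroot
        rcases mul_eq_zero.1 hroot with h | h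
        · exact pow_ne_zero _ hαI h
        · exact he.1 h
      · have h1 : a + (t⁻¹ * ((α : ℂ) * Complex.I)) • e
            = t⁻¹ • (((α : ℂ) * Complex.I) • e + t • a) := by
          rw [smul_add, smul_smul, smul_smul, inv_mul_cancel₀ ht0, one_smul, add_comm]
        have h2 : M (fun _ => a + (t⁻¹ * ((α : ℂ) * Complex.I)) • e) = 0 := by
          rw [h1, homog, hroot, mul_zero]
        have h3 := ha _ h2
        have hpos : 0 < Complex.normSq t := Complex.normSq_pos.2 ht0
        have h4 : (t⁻¹ * ((α : ℂ) * Complex.I)).re = t.im / Complex.normSq t * α := by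
          simp [Complex.inv_re, Complex.inv_im]
          try ring
        rw [h4] at h3
        have : 0 ≤ t.im / Complex.normSq t * α := by positivity
        linarith
  have key2 : ∀ x ∈ V, ∀ s : ℂ, M (fun _ => x + s • a) = 0 → s.im ≤ 0 := by
    intro x hx s hroot
    by_contra! hs
    have := root_persist M hM ha0 (fun α : ℝ => x + ((α : ℂ) * Complex.I) • e)
      (by fun_prop) Complex.im Complex.continuous_im 0 s hs (by simpa using hroot)
    obtain ⟨ε, hε, hb⟩ := Metric.eventually_nhds_iff.1 this
    obtain ⟨t, ht, hr⟩ := hb (y := ε / 2) (by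
      rw [dist_zero_right, Real.norm_eq_abs, abs_of_pos (by positivity)]; linarith)
    exact key x hx (ε / 2) (by positivity) t ht.le hr
  refine ⟨ha0, fun x hx t ht => le_antisymm (key2 x hx t ht) ?_⟩
  have hx' : (((-1 : ℝ)) : ℂ) • x ∈ V := hsmul _ _ hx
  have := key2 _ hx' (-t) (by
    have h1 : (((-1 : ℝ)) : ℂ) • x + (-t) • a = (-1 : ℂ) • (x + t • a) := by
      simp [smul_add]
    rw [h1, homog, ht, mul_zero])
  simpa using this

lemma InCone.change {V : Set W} (hadd : ∀ x ∈ V, ∀ y ∈ V, x + y ∈ V)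
    (hsmul : ∀ (r : ℝ), ∀ x ∈ V, (r : ℂ) • x ∈ V) {k : ℕ}
    {M : MultilinearMap ℂ (fun _ : Fin k => W) ℂ} (hM : Continuous M) {e a b : W} (he : Hyp V M e) (heV : e ∈ V) (haV : a ∈ V) (ha : InCone M e a)
    (hbV : b ∈ V) (hb : InCone M e b) : InCone M a b := by
  have hHa := Hyp.change hadd hsmul hM he haV ha
  have := homotopy_roots M hM hHa.1
      (fun θ => (((1 - (θ : ℝ) : ℝ) : ℂ) • e + ((θ : ℝ) : ℂ) • b)) (by fun_prop) Complex.re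
      Complex.continuous_re ?_ ?_
  · intro t ht
    by_contra! hre
    refine this t hre ?_
    simpa using ht
  · intro θ t ht hroot
    have him := hHa.2 _ (hadd _ (hsmul _ _ heV) _ (hsmul _ _ hbV)) t hroot
    have ht0 : t = 0 := Complex.ext ht him
    subst ht0
    rw [zero_smul, add_zero] at hroot
    by_cases hθ : (θ : ℝ) = 0
    · apply he.1
      simpa [hθ] using hroot
    · have hθ' : ((θ : ℝ) : ℂ) ≠ 0 := by exact_mod_cast hθ
      have hθpos : 0 < (θ : ℝ) := lt_of_le_of_ne θ.2.1 (Ne.symm hθ)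
      have h1 : b + ((((1 - (θ : ℝ)) / (θ : ℝ) : ℝ)) : ℂ) • e
          = (((θ : ℝ) : ℂ))⁻¹ • (((1 - (θ : ℝ) : ℝ) : ℂ) • e + ((θ : ℝ) : ℂ) • b) := by
        rw [smul_add, smul_smul, smul_smul, inv_mul_cancel₀ hθ', one_smul, add_comm]
        congr 2
        push_cast
        rw [div_eq_inv_mul]
      have h3 := hb _ (by rw [h1, homog, hroot, mul_zero])
      rw [Complex.ofReal_re] at h3
      have : 0 ≤ (1 - (θ : ℝ)) / (θ : ℝ) := div_nonneg (by linarith [θ.2.2]) hθpos.le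
      linarith
  · intro t ht hroot
    simp only [Set.Icc.coe_zero, Complex.ofReal_zero, zero_smul, add_zero, sub_zero,
      Complex.ofReal_one, one_smul] at hroot
    by_cases ht0 : t = 0
    · subst ht0
      apply he.1
      simpa using hroot
    · have h1 : a + t⁻¹ • e = t⁻¹ • (e + t • a) := by
        rw [smul_add, smul_smul, inv_mul_cancel₀ ht0, one_smul, add_comm]
      have h3 := ha _ (by rw [h1, homog, hroot, mul_zero])
      rw [Complex.inv_re] at h3
      have hpos : 0 < Complex.normSq t := Complex.normSq_pos.2 ht0
      have : 0 ≤ t.re / Complex.normSq t := by positivity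
      linarith

/-- Gauss-Lucas consequence -/
lemma deriv_roots {k : ℕ} {M : MultilinearMap ℂ (fun _ : Fin (k+1) => W) ℂ} (hs : MSymm M)
    {a : W} (ha : M (fun _ => a) ≠ 0) (x : W) (S : Set ℂ) (hS : Convex ℝ S)
    (h : ∀ t, M (fun _ => x + t • a) = 0 → t ∈ S) (t : ℂ)
    (ht : M.curryLeft a (fun _ => x + t • a) = 0) : t ∈ S := by
  obtain ⟨p, hp1, hp2, hp3, hp4⟩ := exists_line_poly (k+1) M x a
  have hdeg : p.natDegree = k + 1 :=
    le_antisymm hp2 (Polynomial.le_natDegree_of_ne_zero (by rw [hp3]; exact ha))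
  have hd0 : p.derivative ≠ 0 := by
    intro h0
    have := Polynomial.derivative_eq_zero.1 h0
    omega
  have hp0 : p ≠ 0 := by rintro rfl; simp at hd0
  have hpos : 0 < p.degree := Polynomial.natDegree_pos_iff_degree_pos.1 (by omega)
  have hmem : t ∈ p.derivative.rootSet ℂ := by
    rw [Polynomial.mem_rootSet]
    refine ⟨hd0, ?_⟩
    rw [Polynomial.coe_aeval_eq_eval, hp4]
    simp [hs.update, ht]
  have := Polynomial.rootSet_derivative_subset_convexHull_rootSet hpos hmem
  refine convexHull_min ?_ hS this
  intro z hz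
  rw [Polynomial.mem_rootSet] at hz
  apply h
  rw [← hp1]
  simpa using hz.2

/-- Gårding: the polarized form does not vanish on the cone. -/
lemma garding_ne_zero {V : Set W} (hadd : ∀ x ∈ V, ∀ y ∈ V, x + y ∈ V)
    (hsmul : ∀ (r : ℝ), ∀ x ∈ V, (r : ℂ) • x ∈ V) :
    ∀ (k : ℕ) (M : MultilinearMap ℂ (fun _ : Fin k => W) ℂ), Continuous M → MSymm M →
      ∀ e ∈ V, Hyp V M e → ∀ a : Fin k → W, (∀ i, a i ∈ V) → (∀ i, InCone M e (a i)) →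
        M a ≠ 0 := by
  intro k
  induction k with
  | zero =>
    intro M _ _ e _ he a _ _
    rw [Subsingleton.elim a (fun _ => e)]
    exact he.1
  | succ k ih =>
    intro M hM hs e heV he a haV ha
    have hH := Hyp.change hadd hsmul hM he (haV 0) (ha 0)
    have hC : ∀ i, InCone M (a 0) (a i) := fun i =>
      InCone.change hadd hsmul hM he heV (haV 0) (ha 0) (haV i) (ha i)
    have hcons : (fun _ : Fin (k+1) => a 0) = Fin.cons (a 0) (fun _ : Fin k => a 0) := by
      funext i; refine Fin.cases ?_ (fun j => ?_) i <;> simp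
    have hQc : Continuous (M.curryLeft (a 0)) := by
      have : Continuous fun v : Fin k → W => M (Fin.cons (a 0) v) := by
        refine hM.comp (continuous_pi fun i => ?_)
        refine Fin.cases ?_ (fun j => ?_) i
        · simpa using continuous_const
        · simpa using continuous_apply j
      exact this
    have := ih (M.curryLeft (a 0)) hQc (hs.curryLeft _) (a 0) (haV 0) ⟨?_, ?_⟩
      (fun i => a i.succ) (fun i => haV _) ?_
    · rw [MultilinearMap.curryLeft_apply] at this
      intro h0
      apply this
      rw [← h0]
      congr 1
      exact Fin.cons_self_tail a
    · rw [MultilinearMap.curryLeft_apply]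
      intro h0
      apply hH.1
      rw [hcons]
      exact h0
    · intro x hx t ht
      refine deriv_roots hs hH.1 x {z : ℂ | z.im = 0} ?_ (hH.2 x hx) t ht
      intro z hz w hw p q _ _ _
      change z.im = 0 at hz
      change w.im = 0 at hw
      change (p • z + q • w).im = 0
      simp [hz, hw]
    · intro i t ht
      refine deriv_roots hs hH.1 (a i.succ) {z : ℂ | z.re < 0} ?_ (hC i.succ) t ht
      exact convex_halfSpace_re_lt 0

end Garding

section Concrete

open Matrix

/-- the complexified (unnormalized) polarized form -/
noncomputable def Mc (n k : ℕ) :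
    MultilinearMap ℂ (fun _ : Fin k => Matrix (Fin n) (Fin n) ℂ) ℂ :=
  ∑ i : Fin k → Fin n, ∑ j : Fin k → Fin n, (gkdelta i j : ℂ) •
    (MultilinearMap.mkPiAlgebra ℂ (Fin k) ℂ).compLinearMap
      (fun a => Matrix.entryLinearMap ℂ ℂ (i a) (j a))

lemma Mc_apply {n k : ℕ} (A : Fin k → Matrix (Fin n) (Fin n) ℂ) :
    Mc n k A = ∑ i : Fin k → Fin n, ∑ j : Fin k → Fin n,
      (gkdelta i j : ℂ) * ∏ a : Fin k, A a (i a) (j a) := by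
  simp [Mc]

lemma Mc_continuous (n k : ℕ) : Continuous (Mc n k) := by
  have : (Mc n k : (Fin k → Matrix (Fin n) (Fin n) ℂ) → ℂ) = fun A =>
      ∑ i : Fin k → Fin n, ∑ j : Fin k → Fin n,
      (gkdelta i j : ℂ) * ∏ a : Fin k, A a (i a) (j a) := funext Mc_apply
  rw [this]
  refine continuous_finsetSum _ fun i _ => continuous_finsetSum _ fun j _ => ?_
  refine continuous_const.mul (continuous_finsetProd _ fun a _ => ?_)
  exact (continuous_apply a).matrix_elem _ _

lemma gkdelta_perm {k n : ℕ} (i j : Fin k → Fin n) (σ : Equiv.Perm (Fin k)) :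
    gkdelta (i ∘ σ) (j ∘ σ) = gkdelta i j := by
  unfold gkdelta
  rw [← Matrix.det_submatrix_equiv_self σ (Matrix.of fun a b : Fin k => if i a = j b then (1 : ℝ) else 0)]
  rfl

lemma Mc_symm (n k : ℕ) : MSymm (Mc n k) := by
  intro σ v
  rw [Mc_apply, Mc_apply]
  have e := (Equiv.arrowCongr σ (Equiv.refl (Fin n))).symm
  rw [← Equiv.sum_comp (Equiv.arrowCongr σ (Equiv.refl (Fin n))).symm]
  refine Finset.sum_congr rfl fun i _ => ?_
  rw [← Equiv.sum_comp (Equiv.arrowCongr σ (Equiv.refl (Fin n))).symm]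
  refine Finset.sum_congr rfl fun j _ => ?_
  have h1 : ∀ i : Fin k → Fin n, (Equiv.arrowCongr σ (Equiv.refl (Fin n))).symm i = i ∘ σ := by
    intro i; funext a; simp [Equiv.arrowCongr]
  rw [h1, h1, gkdelta_perm]
  congr 1
  exact Equiv.prod_comp σ (fun a => v a (i a) (j a))

lemma Mc_diag_eq {n k : ℕ} (A : Matrix (Fin n) (Fin n) ℂ) :
    Mc n k (fun _ => A) = ∑ σ : Equiv.Perm (Fin k), ((Equiv.Perm.sign σ : ℤ) : ℂ) *
      ∑ i : Fin k → Fin n, ∏ a, A (i a) (i (σ a)) := by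
  rw [Mc_apply]
  simp only [Finset.mul_sum]
  rw [Finset.sum_comm (s := (Finset.univ : Finset (Equiv.Perm (Fin k))))]
  refine Finset.sum_congr rfl fun i _ => ?_
  have : ∀ j : Fin k → Fin n, (gkdelta i j : ℂ) = ∑ σ : Equiv.Perm (Fin k),
      ((Equiv.Perm.sign σ : ℤ) : ℂ) * if i ∘ σ = j then 1 else 0 := by
    intro j
    unfold gkdelta
    rw [Matrix.det_apply']
    push_cast
    refine Finset.sum_congr rfl fun σ _ => ?_
    congr 1
    simp only [Matrix.of_apply]
    rw [← Complex.ofReal_prod, Finset.prod_ite_zero]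
    simp only [funext_iff, Function.comp, Finset.mem_univ, true_imp_iff]
    split_ifs <;> simp
  simp only [this, Finset.sum_mul]
  rw [Finset.sum_comm]
  refine Finset.sum_congr rfl fun σ _ => ?_
  simp

lemma Mc_mul_comm {n k : ℕ} (A B : Matrix (Fin n) (Fin n) ℂ) :
    Mc n k (fun _ => A * B) = Mc n k (fun _ => B * A) := by
  rw [Mc_diag_eq, Mc_diag_eq]
  refine Finset.sum_congr rfl fun σ _ => ?_
  congr 1
  simp only [Matrix.mul_apply, Finset.prod_univ_sum, Fintype.piFinset_univ]
  rw [Finset.sum_comm]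
  refine Finset.sum_congr rfl fun l _ => ?_
  rw [← Equiv.sum_comp (Equiv.arrowCongr σ (Equiv.refl (Fin n)))]
  refine Finset.sum_congr rfl fun i _ => ?_
  have h1 : ∀ a, (Equiv.arrowCongr σ (Equiv.refl (Fin n))) i (σ a) = i a := by
    intro a; simp [Equiv.arrowCongr]
  rw [Finset.prod_mul_distrib, Finset.prod_mul_distrib, mul_comm]
  congr 1
  · simp only [h1]
  · rw [← Equiv.prod_comp σ]
    simp only [h1]

lemma gkdelta_self {k n : ℕ} (i : Fin k → Fin n) :
    gkdelta i i = if Function.Injective i then 1 else 0 := by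
  unfold gkdelta
  split_ifs with h
  · rw [← Matrix.det_one (n := Fin k) (R := ℝ)]
    congr 1
    ext a b
    simp [Matrix.one_apply, h.eq_iff]
  · simp only [Function.Injective, not_forall] at h
    obtain ⟨a, b, hab, hne⟩ := h
    refine Matrix.det_zero_of_row_eq hne ?_
    funext c
    simp [hab]

lemma card_inj_image {n k : ℕ} (S : Finset (Fin n)) (hS : S.card = k) :
    ((Finset.univ.filter fun i : Fin k → Fin n => Function.Injective i).filter
      fun i => Finset.univ.image i = S).card = k.factorial := by
  have h1 : Fintype.card (Fin k ↪ S) = k.factorial := by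
    rw [Fintype.card_embedding_eq]
    simp [hS, Nat.descFactorial_self]
  rw [← h1, ← Finset.card_univ]
  symm
  refine Finset.card_bij (fun f _ a => (f a : Fin n)) ?_ ?_ ?_
  · intro f _
    have hinj : Function.Injective fun a => (f a : Fin n) :=
      Subtype.val_injective.comp f.injective
    simp only [Finset.mem_filter, Finset.mem_univ, true_and]
    refine ⟨hinj, Finset.eq_of_subset_of_card_le ?_ ?_⟩
    · intro x hx
      obtain ⟨a, -, rfl⟩ := Finset.mem_image.1 hx
      exact (f a).2
    · rw [Finset.card_image_of_injective _ hinj, hS]; simp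
  · intro f _ g _ h
    ext a
    exact congrArg Fin.val (congrFun h a)
  · intro i hi
    simp only [Finset.mem_filter, Finset.mem_univ, true_and] at hi
    refine ⟨⟨fun a => ⟨i a, ?_⟩, ?_⟩, Finset.mem_univ _, rfl⟩
    · rw [← hi.2]; exact Finset.mem_image_of_mem _ (Finset.mem_univ _)
    · intro a b hab
      exact hi.1 (congrArg Subtype.val hab)

lemma Mc_diagonal {n k : ℕ} (d : Fin n → ℂ) :
    Mc n k (fun _ => Matrix.diagonal d) =
      (k.factorial : ℂ) * ∑ s ∈ Finset.powersetCard k (Finset.univ : Finset (Fin n)),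
        ∏ i ∈ s, d i := by
  rw [Mc_apply]
  have h1 : ∀ i j : Fin k → Fin n, (gkdelta i j : ℂ) * ∏ a, Matrix.diagonal d (i a) (j a)
      = if i = j then (gkdelta i j : ℂ) * ∏ a, d (i a) else 0 := by
    intro i j
    simp only [Matrix.diagonal_apply]
    rw [Finset.prod_ite_zero]
    simp [funext_iff]
  simp only [h1, Finset.sum_ite_eq, Finset.mem_univ, if_true, gkdelta_self]
  have h2 : ∀ i : Fin k → Fin n,
      (((if Function.Injective i then (1:ℝ) else 0 : ℝ)) : ℂ) * ∏ a, d (i a)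
      = if Function.Injective i then ∏ a, d (i a) else 0 := by
    intro i; split_ifs <;> simp
  simp only [h2]
  rw [← Finset.sum_filter]
  rw [← Finset.sum_fiberwise_of_maps_to
    (t := Finset.powersetCard k (Finset.univ : Finset (Fin n)))
    (g := fun i => Finset.univ.image i)]
  · rw [Finset.mul_sum]
    refine Finset.sum_congr rfl fun S hS => ?_
    rw [← card_inj_image S (Finset.mem_powersetCard.1 hS).2, ← nsmul_eq_mul]
    refine Finset.sum_eq_card_nsmul fun i hi => ?_
    simp only [Finset.mem_filter, Finset.mem_univ, true_and] at hi
    rw [← hi.2, Finset.prod_image (fun a _ b _ h => hi.1 h)]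
  · intro i hi
    simp only [Finset.mem_filter, Finset.mem_univ, true_and] at hi
    rw [Finset.mem_powersetCard]
    refine ⟨Finset.subset_univ _, ?_⟩
    rw [Finset.card_image_of_injective _ hi]; simp

open Polynomial in
lemma esymm_shift {R : Type*} [CommRing R] {n k : ℕ} (hk : k ≤ n) (lam : Fin n → R) (t : R) :
    ∑ s ∈ Finset.powersetCard k (Finset.univ : Finset (Fin n)), ∏ i ∈ s, (lam i + t)
      = (hasseDeriv (n - k) (∏ i, (X + C (lam i)))).eval t := by
  rw [← taylor_coeff]
  have : taylor t (∏ i, (X + C (lam i))) = ∏ i, (X + C (lam i + t)) := by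
    rw [taylor_apply, prod_comp]
    refine Finset.prod_congr rfl fun i _ => ?_
    simp
    ring
  rw [this, Finset.prod_X_add_C_coeff _ _ (by simp)]
  have : (Finset.univ : Finset (Fin n)).card - (n - k) = k := by simp; omega
  rw [this]

open Polynomial in
lemma hasse_coeff {R : Type*} [CommRing R] {n k : ℕ} (hk : k ≤ n) (lam : Fin n → R) (j : ℕ)
    (hj : j ≤ k) :
    (hasseDeriv (n - k) (∏ i, (X + C (lam i)))).coeff j = ((j + (n - k)).choose (n - k) : R) *
      ∑ s ∈ Finset.powersetCard (k - j) (Finset.univ : Finset (Fin n)), ∏ i ∈ s, lam i := by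
  rw [hasseDeriv_coeff, Finset.prod_X_add_C_coeff _ _ (by simp; omega)]
  have : (Finset.univ : Finset (Fin n)).card - (j + (n - k)) = k - j := by simp; omega
  rw [this]

open Polynomial in
lemma iter_deriv_roots (p : ℂ[X]) (hp : ∀ z, p.eval z = 0 → z.im = 0) :
    ∀ m : ℕ, derivative^[m] p ≠ 0 → ∀ z, (derivative^[m] p).eval z = 0 → z.im = 0 := by
  intro m
  induction m with
  | zero => intro _; simpa using hp
  | succ m ih =>
    intro h0 z hz
    rw [Function.iterate_succ_apply'] at h0 hz
    set q := derivative^[m] p with hq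
    have hq0 : q ≠ 0 := by intro h; rw [h] at h0; simp at h0
    have hd : 0 < q.degree := by
      rw [← natDegree_pos_iff_degree_pos]
      by_contra hc
      exact h0 (derivative_eq_zero.2 (by omega))
    have hmem : z ∈ q.derivative.rootSet ℂ := by
      rw [mem_rootSet]
      exact ⟨h0, by simpa using hz⟩
    have := rootSet_derivative_subset_convexHull_rootSet hd hmem
    refine convexHull_min (t := {w : ℂ | w.im = 0}) ?_ ?_ this
    · intro w hw
      rw [mem_rootSet] at hw
      exact ih hq0 w (by simpa using hw.2)
    · intro z hz w hw p q _ _ _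
      change z.im = 0 at hz
      change w.im = 0 at hw
      change (p • z + q • w).im = 0
      simp [hz, hw]

open Polynomial in
lemma esymm_shift_real_roots {n k : ℕ} (hk : k ≤ n) (lam : Fin n → ℝ) (t : ℂ)
    (h : ∑ s ∈ Finset.powersetCard k (Finset.univ : Finset (Fin n)), ∏ i ∈ s, ((lam i : ℂ) + t) = 0) :
    t.im = 0 := by
  rw [esymm_shift hk (fun i => (lam i : ℂ)) t] at h
  set p : ℂ[X] := ∏ i, (X + C (lam i : ℂ)) with hp
  have hne : hasseDeriv (n - k) p ≠ 0 := by
    intro h0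
    have := hasse_coeff hk (fun i => (lam i : ℂ)) k le_rfl
    rw [← hp, h0] at this
    have h1 : (k + (n - k)).choose (n - k) ≠ 0 := (Nat.choose_pos (by omega)).ne'
    have h2 : (((k + (n - k)).choose (n - k) : ℕ) : ℂ) ≠ 0 := by exact_mod_cast h1
    simp only [coeff_zero, Nat.sub_self, Finset.powersetCard_zero, Finset.sum_singleton,
      Finset.prod_empty, mul_one] at this
    exact h2 this.symm
  have hfac : derivative^[n - k] p = ((n - k).factorial : ℂ[X]) * hasseDeriv (n - k) p := by
    have := congrFun (factorial_smul_hasseDeriv (R := ℂ) (n - k)) p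
    rw [← this]
    simp
  have hf0 : (((n - k).factorial : ℕ) : ℂ[X]) ≠ 0 := by
    exact_mod_cast (Nat.factorial_ne_zero _)
  refine iter_deriv_roots p ?_ (n - k) ?_ t ?_
  · intro z hz
    rw [hp, eval_prod, Finset.prod_eq_zero_iff] at hz
    obtain ⟨i, -, hi⟩ := hz
    have := congrArg Complex.im hi
    simpa using this
  · rw [hfac]; exact mul_ne_zero hf0 hne
  · rw [hfac, eval_mul, h, mul_zero]

open Polynomial in
lemma esymm_shift_pos {n k : ℕ} (hk : k ≤ n) (lam : Fin n → ℝ) (hl : inGamma n k lam) (r : ℝ)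
    (hr : 0 ≤ r) :
    0 < ∑ s ∈ Finset.powersetCard k (Finset.univ : Finset (Fin n)), ∏ i ∈ s, (lam i + r) := by
  rw [esymm_shift hk]
  set p : ℝ[X] := ∏ i, (X + C (lam i)) with hp
  have hes : ∀ j ≤ k, 0 < esymm n j lam := by
    intro j hj
    rcases Nat.eq_zero_or_pos j with rfl | h
    · simp [esymm]
    · exact hl j h hj
  have hcoeff : ∀ j ≤ k, 0 < (hasseDeriv (n - k) p).coeff j := by
    intro j hj
    rw [hp, hasse_coeff hk lam j hj]
    have h1 : 0 < (j + (n - k)).choose (n - k) := Nat.choose_pos (by omega)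
    have h2 := hes (k - j) (by omega)
    unfold esymm at h2
    positivity
  have hpdeg : p.natDegree ≤ n := by
    rw [hp]
    refine (natDegree_prod_le _ _).trans ?_
    simp
  have hdeg : (hasseDeriv (n - k) p).natDegree < k + 1 := by
    have := natDegree_hasseDeriv_le p (n - k)
    omega
  rw [eval_eq_sum_range' hdeg, Finset.sum_range_succ']
  have h0 := hcoeff 0 (by omega)
  have : 0 ≤ ∑ j ∈ Finset.range k, (hasseDeriv (n - k) p).coeff (j + 1) * r ^ (j + 1) := by
    refine Finset.sum_nonneg fun j hj => mul_nonneg (hcoeff _ ?_).le (by positivity)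
    have := Finset.mem_range.1 hj
    omega
  simpa using add_pos_of_nonneg_of_pos this h0

/-- complexification of a real matrix -/
noncomputable def cx {n : ℕ} (A : Matrix (Fin n) (Fin n) ℝ) : Matrix (Fin n) (Fin n) ℂ :=
  A.map (fun x : ℝ => (x : ℂ))

lemma cx_mul {n : ℕ} (A B : Matrix (Fin n) (Fin n) ℝ) : cx (A * B) = cx A * cx B :=
  Matrix.map_mul (f := Complex.ofRealHom)

lemma cx_one {n : ℕ} : cx (1 : Matrix (Fin n) (Fin n) ℝ) = 1 := by
  simp [cx, Matrix.map_one]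

lemma Mc_shift {n k : ℕ} {A : Matrix (Fin n) (Fin n) ℝ} (hA : A.IsHermitian) (t : ℂ) :
    Mc n k (fun _ => cx A + t • (1 : Matrix (Fin n) (Fin n) ℂ)) =
      (k.factorial : ℂ) * ∑ s ∈ Finset.powersetCard k (Finset.univ : Finset (Fin n)),
        ∏ i ∈ s, ((hA.eigenvalues i : ℂ) + t) := by
  have hspec := hA.spectral_theorem
  rw [Unitary.conjStarAlgAut_apply] at hspec
  set U : Matrix (Fin n) (Fin n) ℝ := (hA.eigenvectorUnitary : Matrix (Fin n) (Fin n) ℝ) with hU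
  have hUU : star U * U = 1 := by
    rw [hU]; exact Unitary.coe_star_mul_self hA.eigenvectorUnitary
  have hUU' : U * star U = 1 := by
    rw [hU]; exact Unitary.coe_mul_star_self hA.eigenvectorUnitary
  have hcUU : cx (star U) * cx U = 1 := by rw [← cx_mul, hUU, cx_one]
  have hcUU' : cx U * cx (star U) = 1 := by rw [← cx_mul, hUU', cx_one]
  have hD : cx (Matrix.diagonal (RCLike.ofReal ∘ hA.eigenvalues))
      = Matrix.diagonal fun i => (hA.eigenvalues i : ℂ) := by
    unfold cx
    rw [Matrix.diagonal_map (by simp)]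
    rfl
  have h1 : cx A + t • (1 : Matrix (Fin n) (Fin n) ℂ)
      = cx U * (Matrix.diagonal (fun i => (hA.eigenvalues i : ℂ) + t) * cx (star U)) := by
    have h2 : (Matrix.diagonal (fun i => (hA.eigenvalues i : ℂ) + t))
        = Matrix.diagonal (fun i => (hA.eigenvalues i : ℂ)) + t • (1 : Matrix (Fin n) (Fin n) ℂ) := by
      ext i j
      by_cases hij : i = j
      · subst hij; simp
      · simp [hij]
    have h3 : cx A = cx U * (Matrix.diagonal fun i => (hA.eigenvalues i : ℂ)) * cx (star U) := by
      conv_lhs => rw [hspec]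
      rw [cx_mul, cx_mul, hD]
    rw [h2, add_mul, mul_add, ← mul_assoc, ← h3, smul_mul_assoc, mul_smul_comm, one_mul, hcUU']
  rw [h1, Mc_mul_comm, mul_assoc, hcUU, mul_one, Mc_diagonal]

lemma Mc_cx {n k : ℕ} (A : Fin k → Matrix (Fin n) (Fin n) ℝ) :
    Mc n k (fun a => cx (A a)) = ((∑ i : Fin k → Fin n, ∑ j : Fin k → Fin n,
      gkdelta i j * ∏ a : Fin k, A a (i a) (j a) : ℝ) : ℂ) := by
  rw [Mc_apply]
  push_cast
  rfl

lemma Mc_one {n k : ℕ} : Mc n k (fun _ => 1) = ((k.factorial * n.choose k : ℝ) : ℂ) := by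
  rw [← Matrix.diagonal_one, Mc_diagonal]
  simp

/-- Positivity of the unnormalized polarized form on the Gårding cone. -/
lemma pol_pos {n k : ℕ} (hk : k ≤ n) (A : Fin k → Matrix (Fin n) (Fin n) ℝ)
    (hA : ∀ a, (A a).IsHermitian) (hc : ∀ a, inGamma n k (hA a).eigenvalues) :
    0 < ∑ i : Fin k → Fin n, ∑ j : Fin k → Fin n,
      gkdelta i j * ∏ a : Fin k, A a (i a) (j a) := by
  set V : Set (Matrix (Fin n) (Fin n) ℂ) :=
    {x | ∃ B : Matrix (Fin n) (Fin n) ℝ, B.IsHermitian ∧ x = cx B} with hV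
  have hadd : ∀ x ∈ V, ∀ y ∈ V, x + y ∈ V := by
    rintro _ ⟨B, hB, rfl⟩ _ ⟨C, hC, rfl⟩
    refine ⟨B + C, hB.add hC, ?_⟩
    ext i j; simp [cx]
  have hsmul : ∀ (r : ℝ), ∀ x ∈ V, (r : ℂ) • x ∈ V := by
    rintro r _ ⟨B, hB, rfl⟩
    refine ⟨r • B, ?_, ?_⟩
    · unfold Matrix.IsHermitian at *
      rw [Matrix.conjTranspose_smul, hB]; simp
    · ext i j; simp [cx]
  have h1V : (1 : Matrix (Fin n) (Fin n) ℂ) ∈ V := ⟨1, Matrix.isHermitian_one, cx_one.symm⟩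
  have hfac : (k.factorial : ℂ) ≠ 0 := by exact_mod_cast Nat.factorial_ne_zero k
  have hpos1 : (0 : ℝ) < k.factorial * n.choose k := by
    have := Nat.choose_pos hk
    have := Nat.factorial_pos k
    positivity
  have hHyp : Hyp V (Mc n k) 1 := by
    refine ⟨?_, ?_⟩
    · rw [Mc_one]; exact_mod_cast hpos1.ne'
    · rintro _ ⟨B, hB, rfl⟩ t ht
      rw [Mc_shift hB] at ht
      exact esymm_shift_real_roots hk _ t ((mul_eq_zero.1 ht).resolve_left hfac)
  have hcone : ∀ a, InCone (Mc n k) 1 (cx (A a)) := by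
    intro a t ht
    rw [Mc_shift (hA a)] at ht
    have h0 := (mul_eq_zero.1 ht).resolve_left hfac
    have him := esymm_shift_real_roots hk _ t h0
    by_contra! hre
    have ht' : t = ((t.re : ℝ) : ℂ) := by apply Complex.ext <;> simp [him]
    rw [ht'] at h0
    have := esymm_shift_pos hk _ (hc a) t.re hre
    apply this.ne'
    exact_mod_cast h0
  -- move along the segment from the identity
  set y : ℝ → Fin k → Matrix (Fin n) (Fin n) ℝ := fun θ a => (1 - θ) • 1 + θ • A a with hy
  set S : (Fin k → Matrix (Fin n) (Fin n) ℝ) → ℝ := fun A =>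
    ∑ i : Fin k → Fin n, ∑ j : Fin k → Fin n, gkdelta i j * ∏ a : Fin k, A a (i a) (j a) with hS
  have hcx : ∀ θ a, cx (y θ a) = ((1 - θ : ℝ) : ℂ) • 1 + (θ : ℂ) • cx (A a) := by
    intro θ a
    ext i j
    by_cases hij : i = j
    · subst hij; simp [cx, hy]
    · simp [cx, hy, hij]
  have hAV : ∀ a, cx (A a) ∈ V := fun a => ⟨A a, hA a, rfl⟩
  have hne : ∀ θ ∈ Set.Icc (0:ℝ) 1, S (y θ) ≠ 0 := by
    intro θ hθ h0
    refine garding_ne_zero hadd hsmul k (Mc n k) (Mc_continuous n k) (Mc_symm n k) 1 h1V hHyp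
      (fun a => cx (y θ a)) ?_ ?_ ?_
    · intro a
      rw [hcx]
      exact hadd _ (hsmul _ _ h1V) _ (hsmul _ _ (hAV a))
    · intro a t ht
      rw [hcx] at ht
      have hcomb : ((1 - θ : ℝ) : ℂ) • (1 : Matrix (Fin n) (Fin n) ℂ) + (θ : ℂ) • cx (A a) + t • 1
          = (θ : ℂ) • cx (A a) + (((1 - θ : ℝ) : ℂ) + t) • (1 : Matrix (Fin n) (Fin n) ℂ) := by
        rw [add_smul]; abel
      rw [hcomb] at ht
      rcases eq_or_lt_of_le hθ.1 with h | h
      · subst h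
        simp only [Complex.ofReal_zero, zero_smul, zero_add, sub_zero, Complex.ofReal_one] at ht
        rw [homog] at ht
        have h1 := eq_zero_of_pow_eq_zero ((mul_eq_zero.1 ht).resolve_right hHyp.1)
        have h2 := congrArg Complex.re h1
        simp at h2
        linarith
      · have hθ' : (θ : ℂ) ≠ 0 := by exact_mod_cast h.ne'
        have h1 : cx (A a) + ((θ : ℂ)⁻¹ * (((1 - θ : ℝ) : ℂ) + t)) • (1 : Matrix (Fin n) (Fin n) ℂ)
            = (θ : ℂ)⁻¹ • ((θ : ℂ) • cx (A a) + (((1 - θ : ℝ) : ℂ) + t) • 1) := by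
          rw [smul_add, smul_smul, smul_smul, inv_mul_cancel₀ hθ', one_smul]
        have h2 := hcone a _ (by rw [h1, homog, ht, mul_zero])
        rw [← Complex.ofReal_inv, Complex.re_ofReal_mul] at h2
        have h3 : ((((1 - θ : ℝ) : ℂ)) + t).re < 0 := by
          by_contra! hc
          have : 0 ≤ θ⁻¹ * ((((1 - θ : ℝ) : ℂ)) + t).re := by positivity
          linarith
        rw [Complex.add_re, Complex.ofReal_re] at h3
        linarith [hθ.2]
    · rw [Mc_cx]
      exact_mod_cast h0
  have hcont : Continuous fun θ => S (y θ) := by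
    simp only [hS, hy]
    refine continuous_finsetSum _ fun i _ => continuous_finsetSum _ fun j _ => ?_
    refine continuous_const.mul (continuous_finsetProd _ fun a _ => ?_)
    simp only [Matrix.add_apply, Matrix.smul_apply]
    fun_prop
  have hS0 : 0 < S (y 0) := by
    have h1 : y 0 = fun _ => 1 := by funext a; simp [hy]
    have h2 := Mc_cx (fun _ : Fin k => (1 : Matrix (Fin n) (Fin n) ℝ))
    simp only [cx_one] at h2
    rw [Mc_one] at h2
    have h3 := Complex.ofReal_injective h2
    rw [h1]
    simp only [hS]
    rw [← h3]
    exact hpos1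
  have hS1 : S (y 1) = S A := by
    have : y 1 = A := by funext a; simp [hy]
    rw [this]
  change 0 < S A
  rw [← hS1]
  by_contra! hle
  have := intermediate_value_Icc' (zero_le_one (α := ℝ)) hcont.continuousOn
  obtain ⟨θ, hθ, h0⟩ := this ⟨hle, hS0.le⟩
  exact hne θ hθ h0

end Concrete


lemma polSigma_cons_sub (n m : ℕ) (A B : Matrix (Fin n) (Fin n) ℝ)
    (As : Fin m → Matrix (Fin n) (Fin n) ℝ) :
    polSigma n (m + 1) (Fin.cons A As) - polSigma n (m + 1) (Fin.cons B As)
      = polSigma n (m + 1) (Fin.cons (A - B) As) := by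
  unfold polSigma
  rw [← mul_sub, ← Finset.sum_sub_distrib]
  congr 1
  refine Finset.sum_congr rfl fun i _ => ?_
  rw [← Finset.sum_sub_distrib]
  refine Finset.sum_congr rfl fun j _ => ?_
  simp only [Fin.prod_univ_succ, Fin.cons_zero, Fin.cons_succ, Matrix.sub_apply]
  ring

/-- Monotonicity of the polarized `σₖ` (here `k = m + 1`): if `A − B` has eigenvalues in
`Γₖ⁺` and `A₂,...,A_k` have eigenvalues in `Γₖ⁺`, then
`Σ_k(B,A₂,...,A_k) < Σ_k(A,A₂,...,A_k)`. -/
theorem polSigma_strict_mono (n m : ℕ) (hkn : m + 1 ≤ n)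
    (A B : Matrix (Fin n) (Fin n) ℝ)
    (hAB : (A - B).IsHermitian) (hABcone : inGamma n (m + 1) hAB.eigenvalues)
    (As : Fin m → Matrix (Fin n) (Fin n) ℝ) (hAs : ∀ a, (As a).IsHermitian)
    (hAscone : ∀ a, inGamma n (m + 1) (hAs a).eigenvalues) :
    polSigma n (m + 1) (Fin.cons B As) < polSigma n (m + 1) (Fin.cons A As) := by
  have hcons : ∀ a, ((Fin.cons (A - B) As : Fin (m+1) → Matrix (Fin n) (Fin n) ℝ) a).IsHermitian := by
    intro a
    refine Fin.cases ?_ (fun j => ?_) a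
    · simpa using hAB
    · simpa using hAs j
  have hpos := pol_pos hkn (Fin.cons (A - B) As) hcons (by
    intro a
    refine Fin.cases ?_ (fun j => ?_) a
    · exact hABcone
    · exact hAscone j)
  rw [← sub_pos, polSigma_cons_sub]
  unfold polSigma
  have := Nat.factorial_pos (m + 1 - 1)
  exact mul_pos (by positivity) hpos
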